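/- Let N ≥ 2 be an integer, p a real with 1 < p < N, α > 0, and k ≥ 0 an integer. Set λ_k := k(N+k−2), ρ_k := ( √( ((p−2)(N+α)+N−p)² + 4(p−1)λ_k ) − ((p−2)(N+α)+N−p) ) / (2(p−1)), ν_k := ( √( (N−p)² + 4(p−1)λ_k ) + 2ρ_k(p−1) + N−p ) / (2(p+α)), and μ_{1,k} := ( (p+α)² ν_k(ν_k+1) + ν_k (p+α)(p−2)(N+α) ) / ( (N+α)(Np+pα−N+p) ). Then the function φ(r) := r^{ρ_k} (1 + r^{(p+α)/(p−1)})^{−ν_k} satisfies, for every r > 0: −(p−1) φ''(r) − (φ'(r)/r) · ( (N−1) + (p−2)(N+α)/(1+r^{(p+α)/(p−1)}) ) + λ_k φ(r)/r² = μ_{1,k} · ( (N+α)(Np+pα−N+p)/(p−1) ) · r^{(p+α)/(p−1)−2} (1+r^{(p+α)/(p−1)})^{−2} φ(r). (This identifies φ as the first eigenfunction, with eigenvalue μ_{1,k}, of the k-th spherical-harmonic mode of the linearized operator at U_α.) -/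

import Mathlib

open MeasureTheory Real

noncomputable section

/-- The logarithmic derivative of `x ^ ρ * (1 + x ^ m) ^ (-ν)` is
`(ρ - ν * m * x ^ m / (1 + x ^ m)) / x`. -/
lemma hasDerivAt_rpow_mul_one_add_rpow (ρ ν m : ℝ) {x : ℝ} (hx : 0 < x) :
    HasDerivAt (fun r : ℝ => r ^ ρ * (1 + r ^ m) ^ (-ν))
      (x ^ ρ * (1 + x ^ m) ^ (-ν) * ((ρ - ν * m * (x ^ m / (1 + x ^ m))) / x)) x := by
  have ht : 0 < x ^ m := rpow_pos_of_pos hx m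
  have hw : 0 < 1 + x ^ m := by positivity
  have h1 := hasDerivAt_rpow_const (x := x) (p := ρ) (Or.inl hx.ne')
  have h2 := ((hasDerivAt_rpow_const (x := x) (p := m) (Or.inl hx.ne')).const_add 1).rpow_const
    (p := -ν) (Or.inl hw.ne')
  refine (h1.mul h2).congr_deriv ?_
  rw [rpow_sub_one hx.ne', rpow_sub_one hx.ne', rpow_sub_one hw.ne']
  field_simp
  ring

lemma hasDerivAt_rpow_div_one_add_rpow (m : ℝ) {x : ℝ} (hx : 0 < x) :
    HasDerivAt (fun r : ℝ => r ^ m / (1 + r ^ m)) (m * x ^ m / (x * (1 + x ^ m) ^ 2)) x := by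
  have ht : 0 < x ^ m := rpow_pos_of_pos hx m
  have hw : 0 < 1 + x ^ m := by positivity
  have h := hasDerivAt_rpow_const (x := x) (p := m) (Or.inl hx.ne')
  refine (h.div (h.const_add 1) hw.ne').congr_deriv ?_
  rw [rpow_sub_one hx.ne']
  field_simp
  ring

/-- The larger root of `a * x ^ 2 + b * x = l`. -/
lemma quadratic_of_eq_sqrt_sub {a b l x : ℝ} (ha : 0 < a) (hl : 0 ≤ l)
    (hx : x = (√(b ^ 2 + 4 * a * l) - b) / (2 * a)) : a * x ^ 2 + b * x = l := by
  have hs : √(b ^ 2 + 4 * a * l) ^ 2 = b ^ 2 + 4 * a * l := sq_sqrt (by positivity)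
  rw [hx]
  generalize √(b ^ 2 + 4 * a * l) = s at hs
  field_simp
  linear_combination hs

/-- The smaller root of `a * x ^ 2 + b * x = l`. -/
lemma quadratic_of_eq_neg_sqrt_add {a b l x : ℝ} (ha : 0 < a) (hl : 0 ≤ l)
    (hx : x = -(√(b ^ 2 + 4 * a * l) + b) / (2 * a)) : a * x ^ 2 + b * x = l := by
  have hs : √(b ^ 2 + 4 * a * l) ^ 2 = b ^ 2 + 4 * a * l := sq_sqrt (by positivity)
  rw [hx]
  generalize √(b ^ 2 + 4 * a * l) = s at hs
  field_simp
  linear_combination hs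

/-- For `N ≥ 2`, `1 < p < N`, `α > 0`, integer `k ≥ 0`, with
`λ_k = k(N+k-2)`, `ρ_k`, `ν_k`, `μ_{1,k}` as defined, the function
`φ(r) = r^{ρ_k}(1 + r^{(p+α)/(p-1)})^{-ν_k}` satisfies, for every `r > 0`,
`-(p-1)φ'' - (φ'/r)((N-1) + (p-2)(N+α)/(1+r^{(p+α)/(p-1)})) + λ_k φ/r²
  = μ_{1,k} ((N+α)(Np+pα-N+p)/(p-1)) r^{(p+α)/(p-1)-2}(1+r^{(p+α)/(p-1)})^{-2} φ`,
identifying `φ` as the first eigenfunction (with eigenvalue `μ_{1,k}`) of the `k`-th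
spherical-harmonic mode of the linearized operator at `U_α`. -/
theorem stmt_4 (N : ℕ) (hN : 2 ≤ N) (p α : ℝ) (hp1 : 1 < p) (hpN : p < N) (hα : 0 < α)
    (k : ℕ) :
    ∀ lamk rhok nuk mu1k : ℝ, ∀ φ : ℝ → ℝ,
      lamk = (k : ℝ) * ((N : ℝ) + k - 2) →
      rhok = (Real.sqrt (((p - 2) * ((N : ℝ) + α) + N - p) ^ 2 + 4 * (p - 1) * lamk)
          - ((p - 2) * ((N : ℝ) + α) + N - p)) / (2 * (p - 1)) →
      nuk = (Real.sqrt (((N : ℝ) - p) ^ 2 + 4 * (p - 1) * lamk)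
          + 2 * rhok * (p - 1) + N - p) / (2 * (p + α)) →
      mu1k = ((p + α) ^ 2 * nuk * (nuk + 1) + nuk * (p + α) * (p - 2) * ((N : ℝ) + α)) /
          (((N : ℝ) + α) * ((N : ℝ) * p + p * α - N + p)) →
      (φ = fun r => r ^ rhok * (1 + r ^ ((p + α) / (p - 1))) ^ (-nuk)) →
      ∀ r : ℝ, 0 < r →
        DifferentiableAt ℝ φ r ∧ DifferentiableAt ℝ (deriv φ) r ∧
        -(p - 1) * deriv (deriv φ) r -
            (deriv φ r / r) * (((N : ℝ) - 1) +
              (p - 2) * ((N : ℝ) + α) / (1 + r ^ ((p + α) / (p - 1)))) +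
            lamk * φ r / r ^ 2 =
          mu1k * (((N : ℝ) + α) * ((N : ℝ) * p + p * α - N + p) / (p - 1)) *
            r ^ ((p + α) / (p - 1) - 2) * (1 + r ^ ((p + α) / (p - 1))) ^ (-(2 : ℝ)) * φ r := by
  intro lamk rhok nuk mu1k φ hlam hrho hnu hmu hφ r hr
  have hp : 0 < p - 1 := by linarith
  have hpα : 0 < p + α := by linarith
  have hN' : (2 : ℝ) ≤ N := by exact_mod_cast hN
  have hk : (0 : ℝ) ≤ k := k.cast_nonneg
  have hl : 0 ≤ lamk := hlam ▸ mul_nonneg hk (by linarith)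
  have hC : 0 < ((N : ℝ) + α) * ((N : ℝ) * p + p * α - N + p) := by
    have : 0 < (N : ℝ) * (p - 1) := by positivity
    have : 0 < p * α := by positivity
    exact mul_pos (by linarith) (by linarith)
  have hmuC : mu1k * (((N : ℝ) + α) * ((N : ℝ) * p + p * α - N + p)) =
      (p + α) ^ 2 * nuk * (nuk + 1) + nuk * (p + α) * (p - 2) * ((N : ℝ) + α) := by
    rw [hmu, div_mul_cancel₀ _ hC.ne']
  obtain ⟨m, hm⟩ : ∃ m, m = (p + α) / (p - 1) := ⟨_, rfl⟩
  have hmp : p + α = m * (p - 1) := by rw [hm, div_mul_cancel₀ _ hp.ne']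
  have hzero : (p - 1) * rhok ^ 2 + ((p - 2) * ((N : ℝ) + α) + N - p) * rhok = lamk :=
    quadratic_of_eq_sqrt_sub hp hl hrho
  have hinfty : (p - 1) * (rhok - nuk * m) ^ 2 + ((N : ℝ) - p) * (rhok - nuk * m) = lamk := by
    refine quadratic_of_eq_neg_sqrt_add hp hl ?_
    rw [hnu, hm]
    field_simp
    ring
  rw [← hm] at hφ ⊢
  have hd (x : ℝ) (hx : 0 < x) :
      HasDerivAt φ (φ x * ((rhok - nuk * m * (x ^ m / (1 + x ^ m))) / x)) x := by
    rw [hφ]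
    exact hasDerivAt_rpow_mul_one_add_rpow rhok nuk m hx
  have hd2 := ((hd r hr).mul ((((hasDerivAt_rpow_div_one_add_rpow m hr).const_mul
    (nuk * m)).const_sub rhok).div (hasDerivAt_id r) hr.ne')).congr_of_eventuallyEq
    (f₁ := deriv φ) (by
      filter_upwards [lt_mem_nhds hr] with x hx using (hd x hx).deriv)
  refine ⟨(hd r hr).differentiableAt, hd2.differentiableAt, ?_⟩
  have ht : 0 < r ^ m := rpow_pos_of_pos hr m
  have hw : 0 < 1 + r ^ m := by positivity
  rw [hd2.deriv, (hd r hr).deriv, ← mul_div_assoc mu1k, hmuC, hmp, rpow_sub hr, rpow_neg hw.le,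
    rpow_two, rpow_two]
  simp only [id, Pi.div_apply]
  generalize φ r = f
  generalize r ^ m = t at ht hw
  have hr0 := hr.ne'
  have hw0 := hw.ne'
  have hp0 := hp.ne'
  field_simp
  linear_combination -f * (1 + t) * hzero - f * t * (1 + t) * hinfty
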